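/- The bracket of the non-standard q-Poisson algebra su_ns^P(2) satisfies the Jacobi identity: for all smooth functions f, g, k : ℝ³ → ℝ, {f,{g,k}} + {g,{k,f}} + {k,{f,g}} = 0, so that su_ns^P(2) is a Poisson algebra. -/

import Mathlib

/-- Partial derivative of a function on ℝ³ in the `i`-th coordinate direction. -/
noncomputable def pd (i : Fin 3) (f : (Fin 3 → ℝ) → ℝ) (x : Fin 3 → ℝ) : ℝ :=
  fderiv ℝ f x (Pi.single i 1)

/-- The bracket of the non-standard q-Poisson algebra su_ns^P(2) on ℝ³ with
coordinates (h, a, b) = (x 0, x 1, x 2):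
{f,g} = (sinh(za)/z)(∂_h f ∂_a g − ∂_a f ∂_h g)
      − b·cosh(za)(∂_h f ∂_b g − ∂_b f ∂_h g)
      + 2h(∂_a f ∂_b g − ∂_b f ∂_a g). -/
noncomputable def suns2Bracket (z : ℝ) (f g : (Fin 3 → ℝ) → ℝ) (x : Fin 3 → ℝ) : ℝ :=
  (Real.sinh (z * x 1) / z) * (pd 0 f x * pd 1 g x - pd 1 f x * pd 0 g x)
  - x 2 * Real.cosh (z * x 1) * (pd 0 f x * pd 2 g x - pd 2 f x * pd 0 g x)
  + 2 * x 0 * (pd 1 f x * pd 2 g x - pd 2 f x * pd 1 g x)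

theorem HasFDerivAt.pd_eq {f : (Fin 3 → ℝ) → ℝ} {f' : (Fin 3 → ℝ) →L[ℝ] ℝ} {x : Fin 3 → ℝ}
    (hf : HasFDerivAt f f' x) (i : Fin 3) : pd i f x = f' (Pi.single i 1) := by
  rw [pd, hf.fderiv]

theorem ContDiff.pd {f : (Fin 3 → ℝ) → ℝ} (hf : ContDiff ℝ (⊤ : ℕ∞) f) (i : Fin 3) :
    ContDiff ℝ (⊤ : ℕ∞) (pd i f) :=
  (hf.fderiv_right (m := (⊤ : ℕ∞)) (by simp)).clm_apply contDiff_const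

/-- Partial derivatives of a smooth function commute. -/
theorem pd_comm {f : (Fin 3 → ℝ) → ℝ} (hf : ContDiff ℝ (⊤ : ℕ∞) f) (i j : Fin 3)
    (x : Fin 3 → ℝ) : pd i (pd j f) x = pd j (pd i f) x := by
  have hd : DifferentiableAt ℝ (fderiv ℝ f) x :=
    (hf.fderiv_right (m := (⊤ : ℕ∞)) (by simp)).differentiable (by simp) x
  have key (i j : Fin 3) :
      pd i (pd j f) x = fderiv ℝ (fderiv ℝ f) x (Pi.single i 1) (Pi.single j 1) := by
    have h := hd.hasFDerivAt.clm_apply (hasFDerivAt_const (Pi.single j (1 : ℝ)) x)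
    simpa using HasFDerivAt.pd_eq (f := pd j f) h i
  rw [key, key]
  refine (hf.contDiffAt.isSymmSndFDerivAt ?_).eq _ _
  rw [minSmoothness_of_isRCLikeNormedField]
  exact WithTop.coe_le_coe.2 (le_top : (2 : ℕ∞) ≤ ⊤)

/-- The Leibniz rule for a partial derivative of the bracket. -/
theorem pd_suns2Bracket {z : ℝ} (hz : z ≠ 0) {f g : (Fin 3 → ℝ) → ℝ}
    (hf : ContDiff ℝ (⊤ : ℕ∞) f) (hg : ContDiff ℝ (⊤ : ℕ∞) g) (i : Fin 3) (x : Fin 3 → ℝ) :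
    pd i (suns2Bracket z f g) x =
      Real.cosh (z * x 1) * (Pi.single i 1 : Fin 3 → ℝ) 1 *
          (pd 0 f x * pd 1 g x - pd 1 f x * pd 0 g x)
      + Real.sinh (z * x 1) / z *
          (pd i (pd 0 f) x * pd 1 g x + pd 0 f x * pd i (pd 1 g) x
            - (pd i (pd 1 f) x * pd 0 g x + pd 1 f x * pd i (pd 0 g) x))
      - ((Pi.single i 1 : Fin 3 → ℝ) 2 * Real.cosh (z * x 1)
          + x 2 * (Real.sinh (z * x 1) * (z * (Pi.single i 1 : Fin 3 → ℝ) 1))) *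
          (pd 0 f x * pd 2 g x - pd 2 f x * pd 0 g x)
      - x 2 * Real.cosh (z * x 1) *
          (pd i (pd 0 f) x * pd 2 g x + pd 0 f x * pd i (pd 2 g) x
            - (pd i (pd 2 f) x * pd 0 g x + pd 2 f x * pd i (pd 0 g) x))
      + 2 * (Pi.single i 1 : Fin 3 → ℝ) 0 * (pd 1 f x * pd 2 g x - pd 2 f x * pd 1 g x)
      + 2 * x 0 *
          (pd i (pd 1 f) x * pd 2 g x + pd 1 f x * pd i (pd 2 g) x
            - (pd i (pd 2 f) x * pd 1 g x + pd 2 f x * pd i (pd 1 g) x)) := by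
  have hF (j : Fin 3) := ((hf.pd j).differentiable (by simp) x).hasFDerivAt
  have hG (j : Fin 3) := ((hg.pd j).differentiable (by simp) x).hasFDerivAt
  have hX (j : Fin 3) : HasFDerivAt (fun y : Fin 3 → ℝ => y j)
      (ContinuousLinearMap.proj (R := ℝ) (φ := fun _ : Fin 3 => ℝ) j) x := hasFDerivAt_apply j x
  have hM (j l : Fin 3) := ((hF j).mul (hG l)).sub ((hF l).mul (hG j))
  have h := (((((hX 1).const_mul z).sinh.mul_const z⁻¹).mul (hM 0 1)).sub
    (((hX 2).mul ((hX 1).const_mul z).cosh).mul (hM 0 2))).add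
    (((hX 0).const_mul 2).mul (hM 1 2))
  rw [HasFDerivAt.pd_eq (f := suns2Bracket z f g) h i]
  simp [← pd.eq_1]
  field_simp
  ring

/-- the su_ns^P(2) bracket satisfies the Jacobi identity. -/
theorem suns2_jacobi (z : ℝ) (hz : z ≠ 0)
    (f g k : (Fin 3 → ℝ) → ℝ)
    (hf : ContDiff ℝ (⊤ : ℕ∞) f) (hg : ContDiff ℝ (⊤ : ℕ∞) g) (hk : ContDiff ℝ (⊤ : ℕ∞) k) :
    ∀ x : Fin 3 → ℝ,
      suns2Bracket z f (suns2Bracket z g k) x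
      + suns2Bracket z g (suns2Bracket z k f) x
      + suns2Bracket z k (suns2Bracket z f g) x = 0 := by
  intro x
  rw [suns2Bracket, suns2Bracket, suns2Bracket]
  simp only [pd_suns2Bracket hz hf hg, pd_suns2Bracket hz hg hk, pd_suns2Bracket hz hk hf]
  simp only [pd_comm hf 1 0, pd_comm hf 2 0, pd_comm hf 2 1, pd_comm hg 1 0, pd_comm hg 2 0,
    pd_comm hg 2 1, pd_comm hk 1 0, pd_comm hk 2 0, pd_comm hk 2 1]
  simp
  field_simp
  ring
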